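/- Let g ≥ 3 and let a ∈ V satisfy q(a) = 2 (in ZMod 4). Then there exists an element T of the subgroup G of GL(V) generated by the transvections T_{x_i + x_{i+2}} (1 ≤ i ≤ g−2) and the composites T_{x_i + x_{i+1}} ∘ T_{x_{i+2} + x_{i+3}} ∘ T_{x_i + x_{i+1} + x_{i+2} + x_{i+3}} (1 ≤ i ≤ g−3) such that T(a) = x_1 + x_3. -/

import Mathlib

/-- `V = H₁(N_g; ℤ/2)` as the space of `ℤ/2`-vectors of length `g`.
The standard basis vector `x_i` (1-based index `i`) is `basis_x g ⟨i-1, _⟩`. -/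
abbrev Vg (g : ℕ) := Fin g → ZMod 2

/-- The standard basis vector (0-based index). -/
def basis_x (g : ℕ) (i : Fin g) : Vg g := Pi.single i 1

/-- The mod-2 intersection form `B(v,w) = ∑ᵢ vᵢ wᵢ`. -/
def Bform (g : ℕ) (v w : Vg g) : ZMod 2 := ∑ i, v i * w i

/-- The number of odd 1-based indices `i` with `vᵢ = 1` (0-based: even indices). -/
def lenOdd (g : ℕ) (v : Vg g) : ℕ :=
  (Finset.univ.filter fun i : Fin g => v i = 1 ∧ i.val % 2 = 0).card

/-- The number of even 1-based indices `i` with `vᵢ = 1` (0-based: odd indices). -/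
def lenEven (g : ℕ) (v : Vg g) : ℕ :=
  (Finset.univ.filter fun i : Fin g => v i = 1 ∧ i.val % 2 = 1).card

/-- The Guillou–Marin quadratic form of the o-standardly embedded `N_g`. -/
def qform (g : ℕ) (v : Vg g) : ZMod 4 := (lenOdd g v : ZMod 4) - (lenEven g v : ZMod 4)

/-- The transvection `T_a : v ↦ v + B(v,a)·a`, as a linear endomorphism of `V`. -/
def Tv (g : ℕ) (a : Vg g) : Module.End (ZMod 2) (Vg g) where
  toFun v := v + Bform g v a • a
  map_add' v w := by
    have h : Bform g (v + w) a = Bform g v a + Bform g w a := by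
      simp [Bform, add_mul, Finset.sum_add_distrib]
    simp only [h, add_smul]
    abel
  map_smul' c v := by
    have h : Bform g (c • v) a = c * Bform g v a := by
      simp [Bform, Finset.mul_sum, mul_assoc]
    simp only [h, RingHom.id_apply, mul_smul, smul_add]

/-- The generating set of `O_g(q)` from Theorem 4.2: the transvections
`T_{x_i + x_{i+2}}` (1-based `1 ≤ i ≤ g-2`, here 0-based) and the composites
`T_{x_i + x_{i+1}} ∘ T_{x_{i+2} + x_{i+3}} ∘ T_{x_i + x_{i+1} + x_{i+2} + x_{i+3}}`
(1-based `1 ≤ i ≤ g-3`). -/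
def genSet (g : ℕ) : Set (Module.End (ZMod 2) (Vg g))ˣ :=
  {u | ∃ i : ℕ, ∃ h : i + 2 < g,
    (u : Module.End (ZMod 2) (Vg g)) =
      Tv g (basis_x g ⟨i, by omega⟩ + basis_x g ⟨i + 2, h⟩)} ∪
  {u | ∃ i : ℕ, ∃ h : i + 3 < g,
    (u : Module.End (ZMod 2) (Vg g)) =
      Tv g (basis_x g ⟨i, by omega⟩ + basis_x g ⟨i + 1, by omega⟩) *
      Tv g (basis_x g ⟨i + 2, by omega⟩ + basis_x g ⟨i + 3, h⟩) *
      Tv g (basis_x g ⟨i, by omega⟩ + basis_x g ⟨i + 1, by omega⟩ +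
            basis_x g ⟨i + 2, by omega⟩ + basis_x g ⟨i + 3, h⟩)}

lemma Bform_add_right (g : ℕ) (v a b : Vg g) :
    Bform g v (a + b) = Bform g v a + Bform g v b := by
  simp [Bform, mul_add, Finset.sum_add_distrib]

lemma Bform_add_left (g : ℕ) (v w a : Vg g) :
    Bform g (v + w) a = Bform g v a + Bform g w a := by
  simp [Bform, add_mul, Finset.sum_add_distrib]

lemma Bform_smul_left (g : ℕ) (c : ZMod 2) (v a : Vg g) :
    Bform g (c • v) a = c * Bform g v a := by
  simp [Bform, Finset.mul_sum, mul_assoc]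

lemma Bform_basis_x (g : ℕ) (v : Vg g) (i : Fin g) : Bform g v (basis_x g i) = v i := by
  simp [Bform, basis_x, Pi.single_apply]

lemma Tv_apply (g : ℕ) (a v : Vg g) : Tv g a v = v + Bform g v a • a := rfl

lemma Tv_mul_self (g : ℕ) {a : Vg g} (ha : Bform g a a = 0) : Tv g a * Tv g a = 1 := by
  refine LinearMap.ext fun v => ?_
  have h : Bform g (Tv g a v) a = Bform g v a := by
    rw [Tv_apply, Bform_add_left, Bform_smul_left, ha, mul_zero, add_zero]
  simp only [Module.End.mul_apply, Module.End.one_apply]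
  rw [Tv_apply g a (Tv g a v), h, Tv_apply, add_assoc, ← add_smul,
    CharTwo.add_self_eq_zero, zero_smul, add_zero]

/-- A transvection along an isotropic vector, as a unit of the endomorphism ring. -/
def TvUnit (g : ℕ) {a : Vg g} (ha : Bform g a a = 0) : (Module.End (ZMod 2) (Vg g))ˣ :=
  ⟨Tv g a, Tv g a, Tv_mul_self g ha, Tv_mul_self g ha⟩

/-- `w` lies in the orbit of `v` under the group generated by `genSet g`. -/
def Reach (g : ℕ) (v w : Vg g) : Prop :=
  ∃ u ∈ Subgroup.closure (genSet g), (u : Module.End (ZMod 2) (Vg g)) v = w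

lemma Reach.trans {g : ℕ} {v w z : Vg g} (h₁ : Reach g v w) (h₂ : Reach g w z) :
    Reach g v z := by
  obtain ⟨u, hu, rfl⟩ := h₁
  obtain ⟨u', hu', rfl⟩ := h₂
  exact ⟨u' * u, mul_mem hu' hu, rfl⟩

/-- The restriction of a sequence of bits to its first `g` entries. -/
def restr (g : ℕ) (f : ℕ → ZMod 2) : Vg g := fun i => f i

/-- Interchange the entries at `i` and `i + 2`. -/
def shiftMove (i : ℕ) (f : ℕ → ZMod 2) : ℕ → ZMod 2 := fun n =>
  if n = i then f (i + 2) else if n = i + 2 then f i else f n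

/-- The action of the composite generator at `i` on sequences. -/
def windowMove (i : ℕ) (f : ℕ → ZMod 2) : ℕ → ZMod 2 := fun n =>
  if n = i then f i + f (i + 2) + f (i + 3)
  else if n = i + 1 then f (i + 1) + f (i + 2) + f (i + 3)
  else if n = i + 2 then f i + f (i + 1) + f (i + 2)
  else if n = i + 3 then f i + f (i + 1) + f (i + 3)
  else f n

lemma reach_shiftMove {g i : ℕ} (h : i + 2 < g) (f : ℕ → ZMod 2) :
    Reach g (restr g f) (restr g (shiftMove i f)) := by
  have ha : Bform g (basis_x g ⟨i, by omega⟩ + basis_x g ⟨i + 2, h⟩)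
      (basis_x g ⟨i, by omega⟩ + basis_x g ⟨i + 2, h⟩) = 0 := by
    simp only [Bform_add_right, Bform_basis_x, Pi.add_apply]
    simp [basis_x]
    decide
  refine ⟨TvUnit g ha, Subgroup.subset_closure (Or.inl ⟨i, h, rfl⟩), ?_⟩
  change Tv g _ _ = _
  ext ⟨j, hj⟩
  simp only [Tv_apply, Bform_add_right, Bform_basis_x, Pi.add_apply, Pi.smul_apply]
  simp only [basis_x, Pi.single_apply, smul_eq_mul, restr, shiftMove, Fin.mk.injEq]
  have key : ∀ x y : ZMod 2, x + (x + y) = y ∧ y + (x + y) = x := by decide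
  by_cases h1 : j = i
  · subst h1; simp [key]
  by_cases h2 : j = i + 2
  · subst h2; simp [key]
  · simp [h1, h2]

lemma reach_windowMove {g i : ℕ} (h : i + 3 < g) (f : ℕ → ZMod 2) :
    Reach g (restr g f) (restr g (windowMove i f)) := by
  have h1 : Bform g (basis_x g ⟨i, by omega⟩ + basis_x g ⟨i + 1, by omega⟩)
      (basis_x g ⟨i, by omega⟩ + basis_x g ⟨i + 1, by omega⟩) = 0 := by
    simp only [Bform_add_right, Bform_basis_x, Pi.add_apply]
    simp [basis_x]
    decide
  have h2 : Bform g (basis_x g ⟨i + 2, by omega⟩ + basis_x g ⟨i + 3, h⟩)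
      (basis_x g ⟨i + 2, by omega⟩ + basis_x g ⟨i + 3, h⟩) = 0 := by
    simp only [Bform_add_right, Bform_basis_x, Pi.add_apply]
    simp [basis_x]
    decide
  have h3 : Bform g (basis_x g ⟨i, by omega⟩ + basis_x g ⟨i + 1, by omega⟩ +
        basis_x g ⟨i + 2, by omega⟩ + basis_x g ⟨i + 3, h⟩)
      (basis_x g ⟨i, by omega⟩ + basis_x g ⟨i + 1, by omega⟩ +
        basis_x g ⟨i + 2, by omega⟩ + basis_x g ⟨i + 3, h⟩) = 0 := by
    simp only [Bform_add_right, Bform_basis_x, Pi.add_apply]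
    simp [basis_x]
    decide
  refine ⟨TvUnit g h1 * TvUnit g h2 * TvUnit g h3,
    Subgroup.subset_closure (Or.inr ⟨i, h, rfl⟩), ?_⟩
  change Tv g _ (Tv g _ (Tv g _ _)) = _
  ext ⟨j, hj⟩
  simp only [Tv_apply, Bform_add_right, Bform_basis_x, Pi.add_apply, Pi.smul_apply]
  simp only [basis_x, Pi.single_apply, smul_eq_mul, restr, windowMove, Fin.mk.injEq]
  by_cases c0 : j = i
  · subst c0
    simp
    generalize f j = a, f (j + 1) = b, f (j + 2) = c, f (j + 3) = d
    clear * -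
    decide +revert
  by_cases c1 : j = i + 1
  · subst c1
    simp
    generalize f i = a, f (i + 1) = b, f (i + 2) = c, f (i + 3) = d
    clear * -
    decide +revert
  by_cases c2 : j = i + 2
  · subst c2
    simp
    generalize f i = a, f (i + 1) = b, f (i + 2) = c, f (i + 3) = d
    clear * -
    decide +revert
  by_cases c3 : j = i + 3
  · subst c3
    simp
    generalize f i = a, f (i + 1) = b, f (i + 2) = c, f (i + 3) = d
    clear * -
    decide +revert
  · simp [c0, c1, c2, c3]

/-- The contribution of an entry at position `n` to the quadratic form. -/
def qTerm (n : ℕ) (x : ZMod 2) : ZMod 4 := if x = 1 then (if n % 2 = 0 then 1 else -1) else 0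

/-- The contribution of an entry at position `n` to the sum of the positions of the ones. -/
def posTerm (n : ℕ) (x : ZMod 2) : ℕ := if x = 1 then n else 0

lemma qform_restr (g : ℕ) (f : ℕ → ZMod 2) :
    qform g (restr g f) = ∑ n ∈ Finset.range g, qTerm n (f n) := by
  rw [Finset.sum_range fun n => qTerm n (f n)]
  simp only [qform, lenOdd, lenEven, Finset.card_filter, Nat.cast_sum]
  rw [← Finset.sum_sub_distrib]
  refine Finset.sum_congr rfl fun i _ => ?_
  rcases Nat.mod_two_eq_zero_or_one i.val with h | h <;> by_cases hf : f i = 1 <;>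
    simp [restr, qTerm, h, hf]

lemma sum_range_window {M : Type*} [AddCommMonoid M] {g i : ℕ} (h : i + 3 < g) (F : ℕ → M) :
    ∑ n ∈ Finset.range g, F n =
      (F i + F (i + 1) + F (i + 2) + F (i + 3)) +
        ∑ n ∈ (Finset.range g).filter (fun n => n < i ∨ i + 3 < n), F n := by
  rw [← Finset.sum_filter_not_add_sum_filter _ (fun n => n < i ∨ i + 3 < n)]
  congr 1
  have : (Finset.range g).filter (fun n => ¬(n < i ∨ i + 3 < n)) =
      {i, i + 1, i + 2, i + 3} := by
    ext n
    simp only [Finset.mem_filter, Finset.mem_range, Finset.mem_insert, Finset.mem_singleton]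
    omega
  rw [this]
  simp [add_assoc]

lemma sum_range_triple {M : Type*} [AddCommMonoid M] {g i : ℕ} (h : i + 2 < g) (F : ℕ → M) :
    ∑ n ∈ Finset.range g, F n =
      (F i + F (i + 2)) + ∑ n ∈ (Finset.range g).filter (fun n => n ≠ i ∧ n ≠ i + 2), F n := by
  rw [← Finset.sum_filter_not_add_sum_filter _ (fun n => n ≠ i ∧ n ≠ i + 2)]
  congr 1
  have : (Finset.range g).filter (fun n => ¬(n ≠ i ∧ n ≠ i + 2)) = {i, i + 2} := by
    ext n
    simp only [Finset.mem_filter, Finset.mem_range, Finset.mem_insert, Finset.mem_singleton]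
    omega
  rw [this]
  simp

lemma sum_shiftMove {M : Type*} [AddCommMonoid M] {g i : ℕ} (h : i + 2 < g)
    (φ : ℕ → ZMod 2 → M) (f : ℕ → ZMod 2) :
    ∑ n ∈ Finset.range g, φ n (shiftMove i f n) =
      (φ i (f (i + 2)) + φ (i + 2) (f i)) +
        ∑ n ∈ (Finset.range g).filter (fun n => n ≠ i ∧ n ≠ i + 2), φ n (f n) := by
  rw [sum_range_triple h]
  congr 1
  · simp [shiftMove]
  · refine Finset.sum_congr rfl fun n hn => ?_
    simp only [Finset.mem_filter] at hn
    simp [shiftMove, hn.2.1, hn.2.2]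

lemma sum_windowMove {M : Type*} [AddCommMonoid M] {g i : ℕ} (h : i + 3 < g)
    (φ : ℕ → ZMod 2 → M) (f : ℕ → ZMod 2) :
    ∑ n ∈ Finset.range g, φ n (windowMove i f n) =
      (φ i (f i + f (i + 2) + f (i + 3)) + φ (i + 1) (f (i + 1) + f (i + 2) + f (i + 3)) +
        φ (i + 2) (f i + f (i + 1) + f (i + 2)) + φ (i + 3) (f i + f (i + 1) + f (i + 3))) +
        ∑ n ∈ (Finset.range g).filter (fun n => n < i ∨ i + 3 < n), φ n (f n) := by
  rw [sum_range_window h]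
  congr 1
  · simp [windowMove]
  · refine Finset.sum_congr rfl fun n hn => ?_
    simp only [Finset.mem_filter] at hn
    have h0 : n ≠ i := by omega
    have h1 : n ≠ i + 1 := by omega
    have h2 : n ≠ i + 2 := by omega
    have h3 : n ≠ i + 3 := by omega
    simp [windowMove, h0, h1, h2, h3]

lemma qform_shiftMove {g i : ℕ} (h : i + 2 < g) (f : ℕ → ZMod 2) :
    qform g (restr g (shiftMove i f)) = qform g (restr g f) := by
  rw [qform_restr, qform_restr, sum_shiftMove h, sum_range_triple h]
  congr 1
  simp [qTerm, add_comm]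

lemma qform_windowMove {g i : ℕ} (h : i + 3 < g) (f : ℕ → ZMod 2) :
    qform g (restr g (windowMove i f)) = qform g (restr g f) := by
  rw [qform_restr, qform_restr, sum_windowMove h, sum_range_window h]
  congr 1
  generalize f i = a, f (i + 1) = b, f (i + 2) = c, f (i + 3) = d
  have h2 : (i + 2) % 2 = i % 2 := by omega
  have h3 : (i + 3) % 2 = (i + 1) % 2 := by omega
  simp only [qTerm, h2, h3]
  rcases Nat.mod_two_eq_zero_or_one i with hi | hi
  · have h1 : (i + 1) % 2 = 1 := by omega
    simp only [hi, h1]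
    clear * -
    decide +revert
  · have h1 : (i + 1) % 2 = 0 := by omega
    simp only [hi, h1]
    clear * -
    decide +revert

/-- A sequence with `q = 2` that admits none of the position-decreasing moves has ones
exactly at `0` and `2`. -/
lemma eq_of_irreducible {g : ℕ} (hg : 3 ≤ g) {f : ℕ → ZMod 2} (hq : qform g (restr g f) = 2)
    (hs : ∀ i, i + 2 < g → f i = 0 → f (i + 2) = 0)
    (h1110 : ∀ i, i + 3 < g → f i = 1 → f (i + 1) = 1 → f (i + 2) = f (i + 3))
    (h0101 : ∀ i, i + 3 < g → f i = 0 → f (i + 1) = 1 → f (i + 2) = 0 → f (i + 3) = 0)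
    (h10101 : ∀ i, i + 4 < g → f i = 1 → f (i + 1) = 0 → f (i + 2) = 1 → f (i + 3) = 0 →
      f (i + 4) = 0) :
    restr g f = restr g (Pi.single 0 1 + Pi.single 2 1) := by
  have bit : ∀ x : ZMod 2, x = 0 ∨ x = 1 := by decide
  rw [qform_restr] at hq
  obtain ⟨r, rfl⟩ := Nat.exists_eq_add_of_le' hg
  rcases bit (f 1) with f1 | f1
  · have f4 : 4 < r + 3 → f 4 = 0 := by
      intro h
      rcases bit (f 0) with f0 | f0
      · exact hs 2 h (hs 0 (by omega) f0)
      rcases bit (f 2) with f2 | f2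
      · exact hs 2 h f2
      · exact h10101 0 h f0 f1 f2 (hs 1 (by omega) f1)
    have hz : ∀ n, n + 3 < r + 3 → f (n + 3) = 0 := by
      intro n
      induction n using Nat.twoStepInduction with
      | zero => exact fun h => hs 1 h f1
      | one => exact f4
      | more n ih _ => exact fun h => hs (n + 3) h (ih (by omega))
    rw [Finset.sum_range_succ', Finset.sum_range_succ', Finset.sum_range_succ',
      Finset.sum_eq_zero fun n hn => by
        simp [qTerm, hz n (by simpa using hn)]] at hq
    have h02 : f 0 = 1 ∧ f 2 = 1 := by
      rcases bit (f 0) with f0 | f0 <;> rcases bit (f 2) with f2 | f2 <;>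
        simp [qTerm, f0, f1, f2] at hq ⊢ <;> revert hq <;> decide
    ext ⟨j, hj⟩
    match j, hj with
    | 0, _ => simp [restr, h02.1]
    | 1, _ => simp [restr, f1]
    | 2, _ => simp [restr, h02.2]
    | n + 3, h => simp [restr, hz n h]
  · rcases bit (f 0) with f0 | f0
    · have f2 := hs 0 (by omega) f0
      have hz : ∀ n, n + 3 < r + 3 → f (n + 3) = 0 := by
        intro n
        induction n using Nat.twoStepInduction with
        | zero => exact fun h => h0101 0 h f0 f1 f2
        | one => exact fun h => hs 2 h f2
        | more n ih _ => exact fun h => hs (n + 3) h (ih (by omega))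
      rw [Finset.sum_range_succ', Finset.sum_range_succ', Finset.sum_range_succ',
        Finset.sum_eq_zero fun n hn => by
          simp [qTerm, hz n (by simpa using hn)]] at hq
      simp [qTerm, f0, f1, f2] at hq
      exact absurd hq (by decide)
    · have hp : ∀ k, 2 * k + 1 < r + 3 → f (2 * k) = f (2 * k + 1) := by
        intro k
        induction k with
        | zero => intro _; simp [f0, f1]
        | succ k ih =>
          intro h
          have e := ih (by omega)
          rcases bit (f (2 * k)) with h0 | h0
          · exact (hs _ (by omega) h0).trans (hs (2 * k + 1) (by omega) (e ▸ h0)).symm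
          · exact h1110 (2 * k) (by omega) h0 (e ▸ h0)
      have hsum : ∀ k, 2 * k ≤ r + 3 → ∑ n ∈ Finset.range (2 * k), qTerm n (f n) = 0 := by
        intro k
        induction k with
        | zero => simp
        | succ k ih =>
          intro h
          rw [show 2 * (k + 1) = 2 * k + 1 + 1 by ring, Finset.sum_range_succ,
            Finset.sum_range_succ, ih (by omega), ← hp k (by omega)]
          simp [qTerm, Nat.add_mod]
          split_ifs <;> simp
      exfalso
      rcases Nat.even_or_odd' (r + 3) with ⟨k, hk | hk⟩
      · rw [hk, hsum k (by omega)] at hq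
        revert hq; decide
      · rw [hk, Finset.sum_range_succ, hsum k (by omega)] at hq
        rcases bit (f (2 * k)) with h | h <;> simp [qTerm, h] at hq <;> revert hq <;> decide

lemma reach_of_qform_eq_two {g : ℕ} (hg : 3 ≤ g) (f : ℕ → ZMod 2)
    (hq : qform g (restr g f) = 2) :
    Reach g (restr g f) (restr g (Pi.single 0 1 + Pi.single 2 1)) := by
  induction hm : ∑ n ∈ Finset.range g, posTerm n (f n) using Nat.strong_induction_on
    generalizing f with
  | _ m ih =>
  subst hm
  have shift : ∀ i, i + 2 < g → f i = 0 → f (i + 2) = 1 →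
      Reach g (restr g f) (restr g (Pi.single 0 1 + Pi.single 2 1)) := by
    intro i h h0 h2
    refine (reach_shiftMove h f).trans (ih _ ?_ _ ((qform_shiftMove h f).trans hq) rfl)
    rw [sum_shiftMove h, sum_range_triple h fun n => posTerm n (f n)]
    simp [posTerm, h0, h2]
  have window : ∀ i, i + 3 < g →
      ∑ n ∈ Finset.range g, posTerm n (windowMove i f n) <
        ∑ n ∈ Finset.range g, posTerm n (f n) →
      Reach g (restr g f) (restr g (Pi.single 0 1 + Pi.single 2 1)) :=
    fun i h hlt => (reach_windowMove h f).trans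
      (ih _ hlt _ ((qform_windowMove h f).trans hq) rfl)
  by_contra hcon
  have bit : ∀ x : ZMod 2, x = 0 ∨ x = 1 := by decide
  have e2 : (1 + 1 : ZMod 2) = 0 := by decide
  refine hcon ⟨1, one_mem _, eq_of_irreducible hg hq ?_ ?_ ?_ ?_⟩
  · intro i h h0
    exact (bit _).resolve_right fun h2 => hcon (shift i h h0 h2)
  · intro i h h0 h1
    by_contra hne
    refine hcon (window i h ?_)
    rw [sum_windowMove h, sum_range_window h fun n => posTerm n (f n)]
    rcases bit (f (i + 2)) with h2 | h2 <;> rcases bit (f (i + 3)) with h3 | h3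
    · exact absurd (h2.trans h3.symm) hne
    · simp [posTerm, h0, h1, h2, h3, e2]
    · simp [posTerm, h0, h1, h2, h3, e2]
    · exact absurd (h2.trans h3.symm) hne
  · intro i h h0 h1 h2
    refine (bit _).resolve_right fun h3 => hcon (window i h ?_)
    rw [sum_windowMove h, sum_range_window h fun n => posTerm n (f n)]
    simp [posTerm, h0, h1, h2, h3, e2]
    omega
  · intro i h h0 h1 h2 h3
    refine (bit _).resolve_right fun h4 => hcon ?_
    have hi : i + 3 < g := by omega
    have hi' : i + 1 + 3 < g := by omega
    refine ((reach_windowMove hi f).trans (reach_windowMove hi' _)).trans (ih _ ?_ _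
      ((qform_windowMove hi' _).trans ((qform_windowMove hi f).trans hq)) rfl)
    have hA := sum_windowMove hi posTerm f
    have hB := sum_range_window hi fun n => posTerm n (f n)
    have hC := sum_windowMove hi' posTerm (windowMove i f)
    have hD := sum_range_window hi' fun n => posTerm n (windowMove i f n)
    have w1 : windowMove i f (i + 1) = 1 := by simp [windowMove, h1, h2, h3]
    have w2 : windowMove i f (i + 1 + 1) = 0 := by
      simp [windowMove, h0, h1, h2, e2, show i + 1 + 1 ≠ i by omega]
    have w3 : windowMove i f (i + 1 + 2) = 1 := by simp [windowMove, h0, h1, h3, add_assoc]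
    have w4 : windowMove i f (i + 1 + 3) = 1 := by simp [windowMove, h4, add_assoc]
    simp only [posTerm, h0, h1, h2, h3, w1, w2, w3, w4, e2] at hA hB hC hD
    simp [e2] at hA hB hC hD
    simp only [posTerm]
    omega

/-- For `g ≥ 3`, any `a` with `q(a) = 2` can be moved to `x₁ + x₃` by the
group `G` generated by the listed transvections and composites. -/
theorem stmt12 (g : ℕ) (hg : 3 ≤ g) (a : Vg g) (ha : qform g a = 2) :
    ∃ u ∈ Subgroup.closure (genSet g),
      (u : Module.End (ZMod 2) (Vg g)) a =
        basis_x g ⟨0, by omega⟩ + basis_x g ⟨2, by omega⟩ := by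
  have h : restr g (fun n => if h : n < g then a ⟨n, h⟩ else 0) = a := by
    ext i; simp [restr]
  have target : restr g (Pi.single 0 1 + Pi.single 2 1) =
      basis_x g ⟨0, by omega⟩ + basis_x g ⟨2, by omega⟩ := by
    ext i; simp [restr, basis_x, Pi.single_apply, Fin.ext_iff]
  have hr := reach_of_qform_eq_two hg _ (h.symm ▸ ha)
  rwa [h, target] at hr
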